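/- For every C∞-word w, the following three conditions are equivalent: (1) w is right doubly extendable; (2) w is right maximal; (3) for every j ≥ 0 such that D^j(w) has length at least 2, the last two letters of D^j(w) are distinct. Symmetrically, w is left doubly extendable if and only if w is left maximal, if and only if for every j ≥ 0 such that D^j(w) has length at least 2, the first two letters of D^j(w) are distinct. -/

import Mathlib

/- Common framework: words over the alphabet Σ = {1,2} (represented as natural
numbers), run-length encoding, the derivative D, k-differentiable words C^k,
C∞-words, heights, roots, primitives, minimal/maximal words, simple extensions,
minimal forbidden words, and the left frontier Ψ. -/

namespace CinftyWords

/-- A word is a finite sequence of natural numbers. -/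
abbrev Word := List ℕ

/-- `w` is a word over the alphabet Σ = {1,2}. -/
def IsWord (w : Word) : Prop := ∀ x ∈ w, x = 1 ∨ x = 2

/-- Complement of a letter: exchanges 1 and 2. -/
def bar (x : ℕ) : ℕ := 3 - x

/-- Letterwise complement of a word. -/
def comp (w : Word) : Word := w.map bar

/-- Run-length encoding Δ: the sequence of lengths of maximal runs of equal
consecutive letters. -/
def rle (w : Word) : Word := (w.splitBy (· == ·)).map List.length

/-- Drop the first run if it has length 1. -/
def dropFirstRun1 (g : List (List ℕ)) : List (List ℕ) :=
  match g with
  | [] => []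
  | r :: rs => if r.length = 1 then rs else r :: rs

/-- The derivative `D w`: the run-length encoding of the word obtained from `w`
by deleting its first and/or last run when that run has length 1. -/
def D (w : Word) : Word :=
  ((dropFirstRun1 ((dropFirstRun1 (w.splitBy (· == ·))).reverse)).reverse).map List.length

/-- `w` is differentiable: `w` is a word over Σ and so is its run-length encoding. -/
def Diffble (w : Word) : Prop := IsWord w ∧ IsWord (rle w)

/-- The set C^k of k-differentiable words: `D^[j] w` is differentiable for all `j < k`
(so that `D^[k] w` is defined). -/
def CK (k : ℕ) : Set Word := {w | IsWord w ∧ ∀ j < k, Diffble (D^[j] w)}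

/-- The set C∞ of words differentiable arbitrarily many times. -/
def Cinf : Set Word := {w | ∀ k : ℕ, w ∈ CK k}

/-- The height of a C∞-word: the least `k` with `D^[k] w = []`. -/
noncomputable def height (w : Word) : ℕ := sInf {k | D^[k] w = []}

/-- The root of a C∞-word: `D^[height w - 1] w`. -/
noncomputable def root (w : Word) : Word := D^[height w - 1] w

/-- `v` is a primitive of `w`: `v` is differentiable and `D v = w`. -/
def IsPrimitive (v w : Word) : Prop := Diffble v ∧ D v = w

/-- A nonempty C∞-word is maximal if each `D^[j] w` (for `j ≤ height w - 2`) is a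
primitive of `D^[j+1] w` of maximal length (vacuously true when `height w = 1`). -/
def MaximalWord (w : Word) : Prop :=
  w ∈ Cinf ∧ w ≠ [] ∧ ∀ j, j + 2 ≤ height w →
    ∀ v, IsPrimitive v (D^[j + 1] w) → v.length ≤ (D^[j] w).length

/-- A nonempty C∞-word is minimal if each `D^[j] w` (for `j ≤ height w - 2`) is a
primitive of `D^[j+1] w` of minimal length (vacuously true when `height w = 1`). -/
def MinimalWord (w : Word) : Prop :=
  w ∈ Cinf ∧ w ≠ [] ∧ ∀ j, j + 2 ≤ height w →
    ∀ v, IsPrimitive v (D^[j + 1] w) → (D^[j] w).length ≤ v.length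

/-- `w` is right maximal: a suffix of a maximal word. -/
def RightMaximal (w : Word) : Prop := ∃ v, MaximalWord v ∧ w <:+ v

/-- `w` is left maximal: a prefix of a maximal word. -/
def LeftMaximal (w : Word) : Prop := ∃ v, MaximalWord v ∧ w <+: v

/-- `w` is right minimal: a suffix of a minimal word. -/
def RightMinimal (w : Word) : Prop := ∃ v, MinimalWord v ∧ w <:+ v

/-- `w` is left minimal: a prefix of a minimal word. -/
def LeftMinimal (w : Word) : Prop := ∃ v, MinimalWord v ∧ w <+: v

/-- `w` is right doubly extendable: both `w1` and `w2` are C∞-words. -/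
def RightDoublyExt (w : Word) : Prop := w ++ [1] ∈ Cinf ∧ w ++ [2] ∈ Cinf

/-- `w` is left doubly extendable: both `1w` and `2w` are C∞-words. -/
def LeftDoublyExt (w : Word) : Prop := 1 :: w ∈ Cinf ∧ 2 :: w ∈ Cinf

/-- `w` is fully extendable: `1w1`, `1w2`, `2w1`, `2w2` are all C∞-words. -/
def FullyExt (w : Word) : Prop :=
  ∀ x, (x = 1 ∨ x = 2) → ∀ y, (y = 1 ∨ y = 2) → x :: (w ++ [y]) ∈ Cinf

/-- `w'` is a right simple extension of `w`: `w' = w ++ s` is a C∞-word and at each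
step the extension by the complementary letter is not a C∞-word. -/
def RightSimpleExt (w w' : Word) : Prop :=
  w' ∈ Cinf ∧ ∃ s : Word, IsWord s ∧ w' = w ++ s ∧
    ∀ i < s.length, w ++ s.take i ++ [bar (s.getD i 0)] ∉ Cinf

/-- `w'` is a left simple extension of `w`. -/
def LeftSimpleExt (w w' : Word) : Prop := RightSimpleExt w.reverse w'.reverse

/-- `w'` is a simple extension of `w`: a right simple extension of a left simple
extension of `w`. -/
def SimpleExt (w w' : Word) : Prop := ∃ v, LeftSimpleExt w v ∧ RightSimpleExt v w'

/-- `m` is the maximal extension of `w`: a simple extension of `w` of maximal length. -/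
def IsMaximalExtension (w m : Word) : Prop :=
  SimpleExt w m ∧ ∀ v, SimpleExt w v → v.length ≤ m.length

/-- A language is factorial if it is closed under taking factors. -/
def Factorial (F : Set Word) : Prop := ∀ v ∈ F, ∀ u, u <:+: v → u ∈ F

/-- A language is anti-factorial if no word of it is a proper factor of another
word of it. -/
def AntiFactorial (M : Set Word) : Prop := ∀ u ∈ M, ∀ v ∈ M, u ≠ v → ¬ u <:+: v

/-- The set of minimal forbidden words of a (factorial) language `F`: words not
in `F` whose maximal proper prefix and maximal proper suffix are both in `F`. -/
def MF (F : Set Word) : Set Word := {v | v ∉ F ∧ v.dropLast ∈ F ∧ v.tail ∈ F}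

/-- The height of a minimal forbidden word of C∞: `k + 1`, where `k` is the
(unique) integer such that `w` is k-differentiable and `D^[k] w ∈ {111, 222}`. -/
noncomputable def MFheight (w : Word) : ℕ :=
  sInf {k | w ∈ CK k ∧ (D^[k] w = [1, 1, 1] ∨ D^[k] w = [2, 2, 2])} + 1

/-- The left frontier Ψ of a C∞-word: the word of length `height w` over {0,1,2}
recording the first letter of each derivative, with `2` replaced by `0` when the
first two letters of the previous derivative are distinct. -/
noncomputable def psi (w : Word) : List ℕ :=
  (List.range (height w)).map (fun i =>
    if i = 0 then w.getD 0 0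
    else if (D^[i] w).getD 0 0 = 2 ∧ (D^[i - 1] w).getD 0 0 ≠ (D^[i - 1] w).getD 1 0 then 0
    else (D^[i] w).getD 0 0)

end CinftyWords

namespace CinftyWords

/-! ### Run lengths -/

lemma rle_nil : rle [] = [] := rfl

lemma rle_replicate_append {a : ℕ} {n : ℕ} {m : Word} (hm : ∀ b ∈ m.head?, a ≠ b) :
    rle (List.replicate (n + 1) a ++ m) = (n + 1) :: rle m := by
  have hne : List.replicate (n + 1) a ≠ [] := by simp
  rw [rle, List.splitBy_append, List.splitBy_of_isChain hne]
  · simp [rle]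
  · exact List.isChain_replicate_of_rel _ (by simp)
  · intro x hx y hy
    have hxa : x = a := List.eq_of_mem_replicate (List.mem_of_getLast? hx)
    simpa [hxa] using hm y hy

lemma rle_singleton (a : ℕ) : rle [a] = [1] := by
  simpa [rle_nil] using rle_replicate_append (a := a) (n := 0) (m := []) (by simp)

lemma rle_pair (a : ℕ) : rle [a, a] = [2] := by
  simpa [rle_nil] using rle_replicate_append (a := a) (n := 1) (m := []) (by simp)

lemma rle_cons_cons {a b : ℕ} (h : a ≠ b) (l : Word) : rle (a :: b :: l) = 1 :: rle (b :: l) := by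
  simpa using rle_replicate_append (a := a) (n := 0) (m := b :: l) (by simpa using h)

lemma rle_cons_cons_cons {a b : ℕ} (h : a ≠ b) (l : Word) :
    rle (a :: a :: b :: l) = 2 :: rle (b :: l) := by
  simpa using rle_replicate_append (a := a) (n := 1) (m := b :: l) (by simpa using h)

lemma rle_cons_ne_nil (a : ℕ) (l : Word) : rle (a :: l) ≠ [] := by
  simp [rle]

lemma exists_eq_replicate_append (a : ℕ) (l : Word) :
    ∃ n m, a :: l = List.replicate (n + 1) a ++ m ∧ ∀ b ∈ m.head?, a ≠ b := by
  induction l with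
  | nil => exact ⟨0, [], by simp, by simp⟩
  | cons b l ih =>
    by_cases hab : a = b
    · subst hab
      obtain ⟨n, m, h, hm⟩ := ih
      exact ⟨n + 1, m, by rw [h, List.replicate_succ (n := n + 1), List.cons_append], hm⟩
    · exact ⟨0, b :: l, by simp, by simpa using hab⟩

lemma splitBy_reverse (w : Word) :
    w.reverse.splitBy (· == ·) = ((w.splitBy (· == ·)).map List.reverse).reverse := by
  rw [List.splitBy_eq_iff]
  refine ⟨?_, ?_, ?_, ?_⟩
  · conv_lhs => rw [← List.flatten_splitBy (· == ·) w]
    rw [List.reverse_flatten]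
  · simp
  · intro m hm
    simp only [List.mem_reverse, List.mem_map] at hm
    obtain ⟨r, hr, rfl⟩ := hm
    rw [List.isChain_reverse]
    exact (List.isChain_of_mem_splitBy hr).imp (by simp +contextual)
  · rw [List.isChain_reverse, List.isChain_map]
    refine (List.isChain_getLast_head_splitBy (· == ·) w).imp ?_
    rintro r s ⟨hr, hs, h⟩
    refine ⟨by simpa using hs, by simpa using hr, ?_⟩
    simp only [List.getLast_reverse, List.head_reverse]
    simp only [beq_eq_false_iff_ne] at h ⊢
    exact h.symm

lemma rle_reverse (w : Word) : rle w.reverse = (rle w).reverse := by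
  simp [rle, splitBy_reverse, Function.comp_def]

/-- Delete the first entry if it equals `1`. -/
def dropFirstOne : Word → Word
  | [] => []
  | n :: u => if n = 1 then u else n :: u

/-- Delete the last entry if it equals `1`. -/
def dropLastOne (u : Word) : Word := (dropFirstOne u.reverse).reverse

@[simp] lemma dropLastOne_nil : dropLastOne [] = [] := rfl

@[simp] lemma dropLastOne_singleton (n : ℕ) :
    dropLastOne [n] = if n = 1 then [] else [n] := by
  by_cases h : n = 1 <;> simp [dropLastOne, dropFirstOne, h]

lemma dropLastOne_cons {u : Word} (n : ℕ) (hu : u ≠ []) :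
    dropLastOne (n :: u) = n :: dropLastOne u := by
  obtain ⟨v, m, rfl⟩ := List.eq_nil_or_concat u |>.resolve_left hu
  by_cases h : m = 1 <;> simp [dropLastOne, dropFirstOne, h]

lemma dropLastOne_dropFirstOne (u : Word) :
    dropLastOne (dropFirstOne u) = dropFirstOne (dropLastOne u) := by
  rcases u with _ | ⟨n, _ | ⟨m, u⟩⟩
  · rfl
  · by_cases h : n = 1 <;> simp [dropFirstOne, h]
  · rw [dropLastOne_cons n (by simp)]
    by_cases h : n = 1 <;> simp [dropFirstOne, h, dropLastOne_cons]

lemma dropFirstRun1_map_length (g : List (List ℕ)) :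
    (dropFirstRun1 g).map List.length = dropFirstOne (g.map List.length) := by
  cases g with
  | nil => rfl
  | cons r g => by_cases h : r.length = 1 <;> simp [dropFirstRun1, dropFirstOne, h]

lemma D_eq (w : Word) : D w = dropLastOne (dropFirstOne (rle w)) := by
  rw [D, List.map_reverse, dropFirstRun1_map_length, List.map_reverse, dropFirstRun1_map_length,
    dropLastOne, rle]

lemma D_reverse (w : Word) : D w.reverse = (D w).reverse := by
  rw [D_eq, D_eq, dropLastOne_dropFirstOne, rle_reverse]
  simp [dropLastOne]

lemma iterate_D_reverse (j : ℕ) (w : Word) : D^[j] w.reverse = (D^[j] w).reverse := by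
  induction j generalizing w with
  | zero => rfl
  | succ j ih => rw [Function.iterate_succ_apply, D_reverse, ih, Function.iterate_succ_apply]

/-- The run lengths of `w`, omitting the last run if it has length `1`. -/
def rleInit (w : Word) : Word := dropLastOne (rle w)

lemma rleInit_singleton (a : ℕ) : rleInit [a] = [] := by
  simp [rleInit, rle_singleton]

lemma rleInit_pair (a : ℕ) : rleInit [a, a] = [2] := by
  simp [rleInit, rle_pair]

lemma rleInit_cons_cons {a b : ℕ} (h : a ≠ b) (l : Word) :
    rleInit (a :: b :: l) = 1 :: rleInit (b :: l) := by
  rw [rleInit, rle_cons_cons h, dropLastOne_cons _ (rle_cons_ne_nil _ _), rleInit]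

lemma rleInit_cons_cons_cons {a b : ℕ} (h : a ≠ b) (l : Word) :
    rleInit (a :: a :: b :: l) = 2 :: rleInit (b :: l) := by
  rw [rleInit, rle_cons_cons_cons h, dropLastOne_cons _ (rle_cons_ne_nil _ _), rleInit]

/-! ### The derivative in terms of the first run -/

lemma D_nil : D [] = [] := rfl

lemma D_singleton (a : ℕ) : D [a] = [] := by
  simp [D_eq, rle_singleton, dropFirstOne]

lemma D_pair (a : ℕ) : D [a, a] = [2] := by
  simp [D_eq, rle_pair, dropFirstOne]

lemma D_cons_cons {a b : ℕ} (h : a ≠ b) (l : Word) : D (a :: b :: l) = rleInit (b :: l) := by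
  simp [D_eq, rle_cons_cons h, dropFirstOne, rleInit]

lemma D_cons_cons_cons {a b : ℕ} (h : a ≠ b) (l : Word) :
    D (a :: a :: b :: l) = 2 :: rleInit (b :: l) := by
  simp [D_eq, rle_cons_cons_cons h, dropFirstOne, rleInit,
    dropLastOne_cons _ (rle_cons_ne_nil b l)]

/-! ### Differentiable words -/

lemma isWord_cons {a : ℕ} {w : Word} : IsWord (a :: w) ↔ (a = 1 ∨ a = 2) ∧ IsWord w := by
  simp [IsWord]

lemma isWord_nil : IsWord [] := by simp [IsWord]

lemma isWord_reverse {w : Word} : IsWord w.reverse ↔ IsWord w := by simp [IsWord]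

lemma bar_letter {a : ℕ} (ha : a = 1 ∨ a = 2) : bar a = 1 ∨ bar a = 2 := by
  rcases ha with rfl | rfl <;> simp [bar]

lemma bar_ne {a : ℕ} (ha : a = 1 ∨ a = 2) : bar a ≠ a := by
  rcases ha with rfl | rfl <;> simp [bar]

lemma bar_eq {a b : ℕ} (ha : a = 1 ∨ a = 2) (hb : b = 1 ∨ b = 2) (h : a ≠ b) : bar a = b := by
  rcases ha with rfl | rfl <;> rcases hb with rfl | rfl <;> simp_all [bar]

lemma diffble_nil : Diffble [] := ⟨isWord_nil, isWord_nil⟩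

lemma diffble_singleton {a : ℕ} (ha : a = 1 ∨ a = 2) : Diffble [a] := by
  simp [Diffble, rle_singleton, isWord_cons, isWord_nil, ha]

lemma diffble_pair {a : ℕ} (ha : a = 1 ∨ a = 2) : Diffble [a, a] := by
  simp [Diffble, rle_pair, isWord_cons, isWord_nil, ha]

lemma diffble_cons_cons {a b : ℕ} {l : Word} (ha : a = 1 ∨ a = 2) (h : a ≠ b) :
    Diffble (a :: b :: l) ↔ Diffble (b :: l) := by
  simp [Diffble, rle_cons_cons h, isWord_cons (a := a), isWord_cons (a := 1), ha]

lemma diffble_cons_cons_cons {a b : ℕ} {l : Word} (ha : a = 1 ∨ a = 2) (h : a ≠ b) :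
    Diffble (a :: a :: b :: l) ↔ Diffble (b :: l) := by
  simp [Diffble, rle_cons_cons_cons h, isWord_cons (a := a), isWord_cons (a := 2), ha]

lemma not_diffble_cube (a : ℕ) (l : Word) : ¬ Diffble (a :: a :: a :: l) := by
  rintro ⟨-, h⟩
  obtain ⟨n, m, hl, hm⟩ := exists_eq_replicate_append a l
  have hl' : a :: a :: a :: l = List.replicate (n + 2 + 1) a ++ m := by
    rw [hl]; rfl
  rw [hl', rle_replicate_append hm, isWord_cons] at h
  omega

lemma diffble_reverse {w : Word} : Diffble w.reverse ↔ Diffble w := by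
  rw [Diffble, rle_reverse, isWord_reverse, isWord_reverse, Diffble]

/-- Induction on a differentiable word, removing its first run. -/
@[elab_as_elim]
lemma Diffble.run_induction {motive : Word → Prop} {w : Word} (hw : Diffble w)
    (nil : motive [])
    (singleton : ∀ a, (a = 1 ∨ a = 2) → motive [a])
    (pair : ∀ a, (a = 1 ∨ a = 2) → motive [a, a])
    (one : ∀ a b l, (a = 1 ∨ a = 2) → a ≠ b → Diffble (b :: l) → motive (b :: l) →
      motive (a :: b :: l))
    (two : ∀ a b l, (a = 1 ∨ a = 2) → a ≠ b → Diffble (b :: l) → motive (b :: l) →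
      motive (a :: a :: b :: l)) : motive w := by
  match w with
  | [] => exact nil
  | [a] => exact singleton a (hw.1 a (by simp))
  | [a, b] =>
    have ha : a = 1 ∨ a = 2 := hw.1 a (by simp)
    have hb : b = 1 ∨ b = 2 := hw.1 b (by simp)
    by_cases hab : a = b
    · exact hab ▸ pair a ha
    · exact one a b [] ha hab (diffble_singleton hb) (singleton b hb)
  | a :: b :: c :: l =>
    have ha : a = 1 ∨ a = 2 := hw.1 a (by simp)
    by_cases hab : a = b
    · subst hab
      by_cases hac : a = c
      · subst hac
        exact absurd hw (not_diffble_cube a l)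
      · have h := (diffble_cons_cons_cons ha hac).1 hw
        exact two a c l ha hac h (h.run_induction nil singleton pair one two)
    · have h := (diffble_cons_cons ha hab).1 hw
      exact one a b (c :: l) ha hab h (h.run_induction nil singleton pair one two)
termination_by w.length

lemma length_rleInit_lt {w : Word} (hw : Diffble w) (h : w ≠ []) :
    (rleInit w).length < w.length := by
  revert h
  refine hw.run_induction (by simp) ?_ ?_ ?_ ?_
  · simp [rleInit_singleton]
  · simp [rleInit_pair]
  · intro a b l _ hab _ ih _
    simpa [rleInit_cons_cons hab] using ih (by simp)
  · intro a b l _ hab _ ih _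
    have := ih (by simp)
    simp only [rleInit_cons_cons_cons hab, List.length_cons] at this ⊢
    omega

lemma length_le_sum_rleInit {w : Word} (hw : Diffble w) : w.length ≤ (rleInit w).sum + 1 := by
  refine hw.run_induction (by simp) ?_ ?_ ?_ ?_
  · simp
  · simp [rleInit_pair]
  · intro a b l _ hab _ ih
    simp only [rleInit_cons_cons hab, List.length_cons, List.sum_cons] at ih ⊢
    omega
  · intro a b l _ hab _ ih
    simp only [rleInit_cons_cons_cons hab, List.length_cons, List.sum_cons] at ih ⊢
    omega

lemma length_le_sum_D {w : Word} (hw : Diffble w) : w.length ≤ (D w).sum + 2 := by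
  refine hw.run_induction (by simp) ?_ ?_ ?_ ?_
  · simp
  · simp
  · intro a b l _ hab h _
    have := length_le_sum_rleInit h
    simp only [D_cons_cons hab, List.length_cons] at this ⊢
    omega
  · intro a b l _ hab h _
    have := length_le_sum_rleInit h
    simp only [D_cons_cons_cons hab, List.length_cons, List.sum_cons] at this ⊢
    omega

lemma length_D_lt {w : Word} (hw : Diffble w) (h : w ≠ []) : (D w).length < w.length := by
  revert h
  refine hw.run_induction (by simp) ?_ ?_ ?_ ?_
  · simp [D_singleton]
  · simp [D_pair]
  · intro a b l _ hab h _ _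
    have := length_rleInit_lt h (by simp)
    simp only [D_cons_cons hab, List.length_cons] at this ⊢
    omega
  · intro a b l _ hab h _ _
    have := length_rleInit_lt h (by simp)
    simp only [D_cons_cons_cons hab, List.length_cons] at this ⊢
    omega

/-- If a differentiable word starts with two equal letters, its derivative is nonempty, and
prepending the other letter does not change the derivative. -/
lemma D_bar_cons_square {a : ℕ} {l : Word} (h : Diffble (a :: a :: l)) :
    D (a :: a :: l) ≠ [] ∧ Diffble (bar a :: a :: a :: l) ∧
      D (bar a :: a :: a :: l) = D (a :: a :: l) := by
  have ha : a = 1 ∨ a = 2 := h.1 a (by simp)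
  refine ⟨?_, (diffble_cons_cons (bar_letter ha) (bar_ne ha)).2 h, ?_⟩
  · match l with
    | [] => simp [D_pair]
    | b :: l =>
      by_cases hab : a = b
      · subst hab
        exact absurd h (not_diffble_cube a l)
      · simp [D_cons_cons_cons hab]
  · match l with
    | [] => rw [D_cons_cons (bar_ne ha), rleInit_pair, D_pair]
    | b :: l =>
      by_cases hab : a = b
      · subst hab
        exact absurd h (not_diffble_cube a l)
      · rw [D_cons_cons (bar_ne ha), rleInit_cons_cons_cons hab, D_cons_cons_cons hab]

lemma rleInit_prefix {v : Word} (hv : Diffble v) (w : Word) (h : w <+: v) : rleInit w <+: rleInit v := by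
  revert w
  refine hv.run_induction ?_ ?_ ?_ ?_ ?_
  · intro w h
    rw [List.prefix_nil.1 h]
  · intro a _ w h
    rcases w with _ | ⟨x, _ | ⟨y, w⟩⟩ <;>
      simp_all [rleInit, rle_nil, rle_singleton, List.cons_prefix_cons]
  · intro a _ w h
    rcases w with _ | ⟨x, _ | ⟨y, w⟩⟩ <;>
      simp_all [rleInit, rle_nil, rle_singleton, rle_pair, List.cons_prefix_cons]
  · intro a b l _ hab _ ih w h
    rcases w with _ | ⟨x, _ | ⟨y, w⟩⟩
    · simp [rleInit, rle_nil]
    · simp [rleInit_singleton]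
    · simp only [List.cons_prefix_cons] at h
      obtain ⟨rfl, rfl, h⟩ := h
      rw [rleInit_cons_cons hab, rleInit_cons_cons hab]
      exact List.cons_prefix_cons.2 ⟨rfl, ih _ (List.cons_prefix_cons.2 ⟨rfl, h⟩)⟩
  · intro a b l _ hab _ ih w h
    rcases w with _ | ⟨x, _ | ⟨y, _ | ⟨z, w⟩⟩⟩
    · simp [rleInit, rle_nil]
    · simp [rleInit_singleton]
    · simp only [List.cons_prefix_cons] at h
      obtain ⟨rfl, rfl, h⟩ := h
      simp [rleInit_pair, rleInit_cons_cons_cons hab]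
    · simp only [List.cons_prefix_cons] at h
      obtain ⟨rfl, rfl, rfl, h⟩ := h
      rw [rleInit_cons_cons_cons hab, rleInit_cons_cons_cons hab]
      exact List.cons_prefix_cons.2 ⟨rfl, ih _ (List.cons_prefix_cons.2 ⟨rfl, h⟩)⟩

lemma D_eq_of_square {a : ℕ} {l : Word} : D (a :: a :: l) = rleInit (a :: a :: l) := by
  obtain ⟨n, m, h, hm⟩ := exists_eq_replicate_append a l
  have : a :: a :: l = List.replicate (n + 1 + 1) a ++ m := by rw [h]; rfl
  rw [D_eq, rleInit, this, rle_replicate_append hm]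
  simp [dropFirstOne]

lemma D_prefix {w v : Word} (hv : Diffble v) (h : w <+: v) : D w <+: D v := by
  rcases w with _ | ⟨a, _ | ⟨b, w⟩⟩
  · simp [D_nil]
  · simp [D_singleton]
  · obtain ⟨t, rfl⟩ := h
    by_cases hab : a = b
    · subst hab
      simpa [D_eq_of_square] using rleInit_prefix hv _ (List.prefix_append _ _)
    · have := (diffble_cons_cons (hv.1 a (by simp)) hab).1 hv
      simpa [D_cons_cons hab] using rleInit_prefix this _ (List.prefix_append (b :: w) t)

/-! ### The longest primitive -/

/-- The word whose successive run lengths are the letters of `u` followed by `1`, with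
first letter `c`. -/
def expand (c : ℕ) : Word → Word
  | [] => [c]
  | n :: u => List.replicate n c ++ expand (bar c) u

lemma length_expand (c : ℕ) (u : Word) : (expand c u).length = u.sum + 1 := by
  induction u generalizing c with
  | nil => rfl
  | cons n u ih => simp [expand, ih]; omega

lemma expand_spec {c : ℕ} {u : Word} (hc : c = 1 ∨ c = 2) (hu : IsWord u) :
    Diffble (expand c u) ∧ rleInit (expand c u) = u ∧ ∃ l, expand c u = c :: l := by
  induction u generalizing c with
  | nil => exact ⟨diffble_singleton hc, rleInit_singleton c, [], rfl⟩
  | cons n u ih =>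
    rw [isWord_cons] at hu
    obtain ⟨h1, h2, l, hl⟩ := ih (bar_letter hc) hu.2
    rw [expand, hl]
    rw [hl] at h1 h2
    have hb := (bar_ne hc).symm
    rcases hu.1 with rfl | rfl
    · exact ⟨(diffble_cons_cons hc hb).2 h1, by simpa [rleInit_cons_cons hb] using h2, _, rfl⟩
    · exact ⟨(diffble_cons_cons_cons hc hb).2 h1,
        by simpa [rleInit_cons_cons_cons hb] using h2, _, rfl⟩

lemma prefix_expand {w : Word} (hw : Diffble w) (c : ℕ) (l u : Word) (hwc : w = c :: l)
    (hu : IsWord u) (h : rleInit w <+: u) : w <+: expand c u := by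
  revert c l u
  refine hw.run_induction ?_ ?_ ?_ ?_ ?_
  · simp
  · rintro a ha c l u ⟨⟩ hu -
    obtain ⟨-, -, m, hm⟩ := expand_spec ha hu
    simp [hm]
  · rintro a ha c l u ⟨⟩ hu h
    rw [rleInit_pair] at h
    obtain ⟨t, rfl⟩ := h
    exact List.prefix_append [a, a] _
  · rintro a b l ha hab hd ih c l' u ⟨⟩ hu h
    rw [rleInit_cons_cons hab] at h
    obtain ⟨t, rfl⟩ := h
    have := ih _ _ _ rfl (isWord_cons.1 hu).2 (List.prefix_append _ _)
    rw [List.cons_append, expand, bar_eq ha (hd.1 b (by simp)) hab]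
    exact List.cons_prefix_cons.2 ⟨rfl, this⟩
  · rintro a b l ha hab hd ih c l' u ⟨⟩ hu h
    rw [rleInit_cons_cons_cons hab] at h
    obtain ⟨t, rfl⟩ := h
    have := ih _ _ _ rfl (isWord_cons.1 hu).2 (List.prefix_append _ _)
    rw [List.cons_append, expand, bar_eq ha (hd.1 b (by simp)) hab]
    exact List.cons_prefix_cons.2 ⟨rfl, List.cons_prefix_cons.2 ⟨rfl, this⟩⟩

/-! ### C∞-words and heights -/

lemma mem_Cinf_iff {w : Word} : w ∈ Cinf ↔ Diffble w ∧ D w ∈ Cinf := by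
  constructor
  · intro h
    refine ⟨(h 1).2 0 one_pos, fun k => ⟨((h 2).2 1 one_lt_two).1, fun j hj => ?_⟩⟩
    exact (h (k + 1)).2 (j + 1) (by omega)
  · rintro ⟨h, hD⟩ k
    refine ⟨h.1, fun j _ => ?_⟩
    cases j with
    | zero => exact h
    | succ j => exact (hD (j + 1)).2 j (by omega)

lemma nil_mem_Cinf : [] ∈ Cinf := by
  have h (j : ℕ) : D^[j] [] = [] := Function.iterate_fixed D_nil j
  exact fun k => ⟨isWord_nil, fun j _ => (h j).symm ▸ diffble_nil⟩

lemma isWord_of_mem_Cinf {w : Word} (hw : w ∈ Cinf) : IsWord w := (hw 0).1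

lemma mem_Cinf_iff_of_D_eq_nil {w : Word} (h : D w = []) : w ∈ Cinf ↔ Diffble w := by
  rw [mem_Cinf_iff, h, and_iff_left nil_mem_Cinf]

lemma singleton_mem_Cinf {a : ℕ} (ha : a = 1 ∨ a = 2) : [a] ∈ Cinf :=
  (mem_Cinf_iff_of_D_eq_nil (D_singleton a)).2 (diffble_singleton ha)

lemma pair_mem_Cinf {a b : ℕ} (ha : a = 1 ∨ a = 2) (hb : b = 1 ∨ b = 2) : [a, b] ∈ Cinf := by
  by_cases hab : a = b
  · subst hab
    rw [mem_Cinf_iff, D_pair]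
    exact ⟨diffble_pair ha, singleton_mem_Cinf (Or.inr rfl)⟩
  · rw [mem_Cinf_iff_of_D_eq_nil (by rw [D_cons_cons hab, rleInit_singleton]),
      diffble_cons_cons ha hab]
    exact diffble_singleton hb

lemma Cinf_induction {motive : Word → Prop} (nil : motive [])
    (step : ∀ w ∈ Cinf, w ≠ [] → motive (D w) → motive w) {w : Word} (hw : w ∈ Cinf) :
    motive w := by
  by_cases h : w = []
  · exact h ▸ nil
  · have := length_D_lt (mem_Cinf_iff.1 hw).1 h
    exact step w hw h (Cinf_induction nil step (mem_Cinf_iff.1 hw).2)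
termination_by w.length

lemma exists_iterate_D_eq_nil {w : Word} (hw : w ∈ Cinf) : ∃ k, D^[k] w = [] :=
  Cinf_induction (motive := fun w => ∃ k, D^[k] w = []) ⟨0, rfl⟩
    (fun _ _ _ ⟨k, hk⟩ => ⟨k + 1, hk⟩) hw

lemma height_eq_succ {w : Word} (hw : w ∈ Cinf) (h : w ≠ []) : height w = height (D w) + 1 := by
  rw [height, height, ← Nat.sInf_add (n := 1) (p := fun k => D^[k] w = [])]
  · rfl
  · exact Nat.pos_of_ne_zero fun h0 => by
      rcases Nat.sInf_eq_zero.1 h0 with h' | h'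
      · exact h h'
      · obtain ⟨k, hk⟩ := exists_iterate_D_eq_nil hw
        exact Set.eq_empty_iff_forall_notMem.1 h' k hk

lemma height_nil : height [] = 0 := Nat.sInf_eq_zero.2 (Or.inl rfl)

lemma height_pos {w : Word} (hw : w ∈ Cinf) (h : w ≠ []) : 0 < height w := by
  rw [height_eq_succ hw h]
  exact Nat.succ_pos _

/-! ### Left extensions -/

/-- The first two letters of every derivative of length at least `2` are distinct. -/
def LeftAlternating (w : Word) : Prop :=
  ∀ j : ℕ, 2 ≤ (D^[j] w).length → (D^[j] w).getD 0 0 ≠ (D^[j] w).getD 1 0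

lemma leftAlternating_iff {w : Word} :
    LeftAlternating w ↔ (2 ≤ w.length → w.getD 0 0 ≠ w.getD 1 0) ∧ LeftAlternating (D w) := by
  refine ⟨fun h => ⟨h 0, fun j => h (j + 1)⟩, fun h j => ?_⟩
  cases j with
  | zero => exact h.1
  | succ j => exact h.2 j

lemma leftAlternating_nil : LeftAlternating [] := by
  intro j
  simp [Function.iterate_fixed D_nil j]

lemma leftAlternating_cons_cons {a b : ℕ} {l : Word} :
    LeftAlternating (a :: b :: l) ↔ a ≠ b ∧ LeftAlternating (D (a :: b :: l)) := by
  rw [leftAlternating_iff]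
  simp

lemma leftDoublyExt_iff_bar {a : ℕ} {w : Word} (ha : a = 1 ∨ a = 2) :
    LeftDoublyExt w ↔ a :: w ∈ Cinf ∧ bar a :: w ∈ Cinf := by
  rcases ha with rfl | rfl
  · rfl
  · exact and_comm

lemma leftDoublyExt_iff_D {a b : ℕ} {l : Word} (h : Diffble (a :: b :: l)) (hab : a ≠ b) :
    LeftDoublyExt (a :: b :: l) ↔ LeftDoublyExt (D (a :: b :: l)) := by
  have ha : a = 1 ∨ a = 2 := h.1 a (by simp)
  have hbar := bar_ne ha
  have h' := (diffble_cons_cons ha hab).1 h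
  rw [leftDoublyExt_iff_bar ha, mem_Cinf_iff, mem_Cinf_iff (w := bar a :: _),
    D_cons_cons_cons hab, D_cons_cons hbar, rleInit_cons_cons hab, D_cons_cons hab,
    diffble_cons_cons_cons ha hab, diffble_cons_cons (bar_letter ha) hbar,
    and_iff_right h', and_iff_right h, and_comm, LeftDoublyExt]

lemma leftDoublyExt_iff_leftAlternating {w : Word} (hw : w ∈ Cinf) :
    LeftDoublyExt w ↔ LeftAlternating w := by
  refine Cinf_induction (motive := fun w => LeftDoublyExt w ↔ LeftAlternating w) ?_ ?_ hw
  · exact iff_of_true ⟨singleton_mem_Cinf (.inl rfl), singleton_mem_Cinf (.inr rfl)⟩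
      leftAlternating_nil
  · intro w hw h ih
    match w with
    | [a] =>
      have ha := isWord_of_mem_Cinf hw a (by simp)
      refine iff_of_true ⟨pair_mem_Cinf (.inl rfl) ha, pair_mem_Cinf (.inr rfl) ha⟩ ?_
      rw [leftAlternating_iff, D_singleton]
      exact ⟨by simp, leftAlternating_nil⟩
    | a :: b :: l =>
      have hd := (mem_Cinf_iff.1 hw).1
      rw [leftAlternating_cons_cons]
      by_cases hab : a = b
      · subst hab
        refine iff_of_false (fun hl => ?_) (by simp)
        exact not_diffble_cube a l
          (mem_Cinf_iff.1 ((leftDoublyExt_iff_bar (hd.1 a (by simp))).1 hl).1).1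
      · rw [leftDoublyExt_iff_D hd hab, ih, and_iff_right hab]

lemma LeftAlternating.of_prefix {w v : Word} (hv : v ∈ Cinf) (h : w <+: v)
    (hl : LeftAlternating v) : LeftAlternating w := by
  revert w
  refine Cinf_induction
    (motive := fun v => LeftAlternating v → ∀ {w : Word}, w <+: v → LeftAlternating w)
    ?_ ?_ hv hl
  · intro _ w h
    rw [List.prefix_nil.1 h]
    exact leftAlternating_nil
  · intro v hv _ ih hl w h
    rw [leftAlternating_iff] at hl ⊢
    refine ⟨?_, ih hl.2 (D_prefix (mem_Cinf_iff.1 hv).1 h)⟩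
    obtain ⟨t, rfl⟩ := h
    rcases w with _ | ⟨a, _ | ⟨b, w⟩⟩
    · simp
    · simp
    · simpa using hl.1

/-! ### Maximal words -/

lemma maximalWord_iff {w : Word} (hw : w ∈ Cinf) (hD : D w ≠ []) :
    MaximalWord w ↔ (∀ v, IsPrimitive v (D w) → v.length ≤ w.length) ∧ MaximalWord (D w) := by
  have hw0 : w ≠ [] := by
    rintro rfl
    exact hD D_nil
  have hDw := (mem_Cinf_iff.1 hw).2
  have hh := height_eq_succ hw hw0
  have hpos := height_pos hDw hD
  constructor
  · rintro ⟨-, -, h⟩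
    exact ⟨h 0 (by omega), hDw, hD, fun j hj => h (j + 1) (by omega)⟩
  · rintro ⟨h0, -, -, h⟩
    refine ⟨hw, hw0, fun j hj => ?_⟩
    cases j with
    | zero => exact h0
    | succ j => exact h j (by omega)

lemma maximalWord_of_D_eq_nil {w : Word} (hw : w ∈ Cinf) (h : w ≠ []) (hD : D w = []) :
    MaximalWord w := by
  have := height_eq_succ hw h
  rw [hD, height_nil] at this
  exact ⟨hw, h, fun j hj => by omega⟩

lemma MaximalWord.leftAlternating {w : Word} (h : MaximalWord w) : LeftAlternating w := by
  refine Cinf_induction (motive := fun w => MaximalWord w → LeftAlternating w) ?_ ?_ h.1 h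
  · exact fun _ => leftAlternating_nil
  · intro w hw _ ih h
    rw [leftAlternating_iff]
    constructor
    · rcases w with _ | ⟨a, _ | ⟨b, l⟩⟩
      · simp
      · simp
      · rintro - hab
        obtain rfl : a = b := hab
        obtain ⟨h1, h2, h3⟩ := D_bar_cons_square (mem_Cinf_iff.1 hw).1
        have := ((maximalWord_iff hw h1).1 h).1 _ ⟨h2, h3⟩
        simp at this
    · by_cases hD : D w = []
      · rw [hD]
        exact leftAlternating_nil
      · exact ih ((maximalWord_iff hw hD).1 h).2

lemma LeftAlternating.leftMaximal {w : Word} (hw : w ∈ Cinf) (hl : LeftAlternating w) :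
    LeftMaximal w := by
  refine Cinf_induction (motive := fun w => LeftAlternating w → LeftMaximal w) ?_ ?_ hw hl
  · exact fun _ => ⟨[1], maximalWord_of_D_eq_nil (singleton_mem_Cinf (.inl rfl)) (by simp)
      (D_singleton 1), List.nil_prefix⟩
  · intro w hw hw0 ih hl
    by_cases hD : D w = []
    · exact ⟨w, maximalWord_of_D_eq_nil hw hw0 hD, List.prefix_rfl⟩
    match w with
    | [a] => exact absurd (D_singleton a) hD
    | a :: b :: l =>
      rw [leftAlternating_cons_cons] at hl
      obtain ⟨hab, hl⟩ := hl
      obtain ⟨u, hu, hwu⟩ := ih hl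
      have hd := (mem_Cinf_iff.1 hw).1
      have ha : a = 1 ∨ a = 2 := hd.1 a (by simp)
      have hb : b = 1 ∨ b = 2 := hd.1 b (by simp)
      have huw := isWord_of_mem_Cinf hu.1
      obtain ⟨h1, h2, m, hm⟩ := expand_spec hb huw
      have hDu : D (a :: expand b u) = u := by
        rw [hm, D_cons_cons hab, ← hm, h2]
      have hdiff : Diffble (a :: expand b u) := by
        rw [hm, diffble_cons_cons ha hab, ← hm]
        exact h1
      refine ⟨a :: expand b u, (maximalWord_iff ?_ ?_).2 ⟨?_, ?_⟩, ?_⟩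
      · exact mem_Cinf_iff.2 ⟨hdiff, hDu.symm ▸ hu.1⟩
      · exact hDu.symm ▸ hu.2.1
      · rintro v ⟨hv, hDv⟩
        have := length_le_sum_D hv
        rw [hDv, hDu] at this
        simpa [length_expand] using this
      · exact hDu.symm ▸ hu
      · rw [D_cons_cons hab] at hwu
        exact List.cons_prefix_cons.2
          ⟨rfl, prefix_expand ((diffble_cons_cons ha hab).1 hd) b l u rfl huw hwu⟩

lemma leftMaximal_iff_leftAlternating {w : Word} (hw : w ∈ Cinf) :
    LeftMaximal w ↔ LeftAlternating w :=
  ⟨fun ⟨_, hv, h⟩ => hv.leftAlternating.of_prefix hv.1 h, fun h => h.leftMaximal hw⟩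

/-! ### Reversal -/

lemma reverse_mem_Cinf {w : Word} : w.reverse ∈ Cinf ↔ w ∈ Cinf := by
  simp [Cinf, CK, iterate_D_reverse, diffble_reverse, isWord_reverse]

lemma height_reverse (w : Word) : height w.reverse = height w := by
  simp [height, iterate_D_reverse]

lemma MaximalWord.reverse {w : Word} (h : MaximalWord w) : MaximalWord w.reverse := by
  refine ⟨reverse_mem_Cinf.2 h.1, by simpa using h.2.1, fun j hj v hv => ?_⟩
  rw [height_reverse] at hj
  simpa [iterate_D_reverse] using h.2.2 j hj v.reverse
    ⟨diffble_reverse.2 hv.1, by rw [D_reverse, hv.2, iterate_D_reverse, List.reverse_reverse]⟩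

lemma rightMaximal_iff_reverse {w : Word} : RightMaximal w ↔ LeftMaximal w.reverse := by
  constructor
  · rintro ⟨v, hv, h⟩
    exact ⟨v.reverse, hv.reverse, List.reverse_prefix.2 h⟩
  · rintro ⟨v, hv, h⟩
    exact ⟨v.reverse, hv.reverse, List.reverse_prefix.1 (by simpa using h)⟩

lemma rightDoublyExt_iff_reverse {w : Word} : RightDoublyExt w ↔ LeftDoublyExt w.reverse := by
  rw [RightDoublyExt, LeftDoublyExt, ← reverse_mem_Cinf, ← reverse_mem_Cinf (w := w ++ [2])]
  simp

lemma leftAlternating_reverse {w : Word} : LeftAlternating w.reverse ↔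
    ∀ j : ℕ, 2 ≤ (D^[j] w).length →
      (D^[j] w).getD ((D^[j] w).length - 2) 0 ≠ (D^[j] w).getD ((D^[j] w).length - 1) 0 := by
  refine forall_congr' fun j => ?_
  rw [iterate_D_reverse, List.length_reverse]
  refine imp_congr_right fun h => ?_
  rw [ne_comm, List.getD_reverse _ (by omega), List.getD_reverse _ (by omega)]
  rfl

end CinftyWords

open CinftyWords in
/-- For every C∞-word `w`: `w` is right doubly extendable iff `w` is right maximal,
iff every derivative of length at least 2 ends with two distinct letters; symmetrically,
`w` is left doubly extendable iff `w` is left maximal, iff every derivative of length at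
least 2 begins with two distinct letters. -/
theorem right_left_doubly_extendable_iff_maximal (w : Word) (hw : w ∈ Cinf) :
    ((RightDoublyExt w ↔ RightMaximal w) ∧
     (RightDoublyExt w ↔ ∀ j : ℕ, 2 ≤ (D^[j] w).length →
        (D^[j] w).getD ((D^[j] w).length - 2) 0 ≠ (D^[j] w).getD ((D^[j] w).length - 1) 0)) ∧
    ((LeftDoublyExt w ↔ LeftMaximal w) ∧
     (LeftDoublyExt w ↔ ∀ j : ℕ, 2 ≤ (D^[j] w).length →
        (D^[j] w).getD 0 0 ≠ (D^[j] w).getD 1 0)) := by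
  rw [← leftAlternating_reverse, rightDoublyExt_iff_reverse, rightMaximal_iff_reverse]
  have hr := reverse_mem_Cinf.2 hw
  have h1 := leftDoublyExt_iff_leftAlternating hr
  have h2 := leftDoublyExt_iff_leftAlternating hw
  exact ⟨⟨h1.trans (leftMaximal_iff_leftAlternating hr).symm, h1⟩,
    h2.trans (leftMaximal_iff_leftAlternating hw).symm, h2⟩
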